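/- Let Γ be a non-uniform lattice in G = SL(2,ℝ), let x₀ ∈ Γ\G be a point whose forward H-trajectory diverges (x₀h(s) leaves every compact subset of Γ\G as s → +∞), and let C ⊆ Γ\G be a compact subset. Then there exists M₁ > 0 such that x₀h(s)a(T) ∉ C for all T ∈ ℝ and all s > 0 with s > |T| + M₁. In particular, for every continuous function f on Γ\G with support contained in C and every T ∈ ℝ, ∫₀^∞ f(x₀h(s)a(T)) ds = ∫₀^{|T|+M₁} f(x₀h(s)a(T)) ds. -/

import Mathlib

noncomputable section
open MeasureTheory Matrix Filter Topology

abbrev SL2 : Type := Matrix.SpecialLinearGroup (Fin 2) ℝ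

instance : TopologicalSpace SL2 :=
  TopologicalSpace.induced (fun g : SL2 => (g : Matrix (Fin 2) (Fin 2) ℝ)) inferInstance

instance : MeasurableSpace SL2 := borel SL2

/-- `h(s) = [[cosh(s/2), sinh(s/2)], [sinh(s/2), cosh(s/2)]]` -/
def hmat (s : ℝ) : SL2 :=
  ⟨!![Real.cosh (s/2), Real.sinh (s/2); Real.sinh (s/2), Real.cosh (s/2)], by
    rw [Matrix.det_fin_two_of]
    nlinarith [Real.cosh_sq_sub_sinh_sq (s/2)]⟩

/-- `a(t) = [[e^{t/2}, 0], [0, e^{-t/2}]]` -/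
def amat (t : ℝ) : SL2 :=
  ⟨!![Real.exp (t/2), 0; 0, Real.exp (-(t/2))], by
    rw [Matrix.det_fin_two_of]
    rw [← Real.exp_add]
    simp⟩

/-- the quotient `Γ\G` by right cosets `Γg` -/
def XQuot (Γ : Subgroup SL2) : Type := Quotient (QuotientGroup.rightRel Γ)

instance (Γ : Subgroup SL2) : TopologicalSpace (XQuot Γ) :=
  inferInstanceAs (TopologicalSpace (Quotient (QuotientGroup.rightRel Γ)))

instance (Γ : Subgroup SL2) : MeasurableSpace (XQuot Γ) := borel (XQuot Γ)

/-- the natural projection `G → Γ\G`, `g ↦ Γg` -/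
def qmk (Γ : Subgroup SL2) (g : SL2) : XQuot Γ := Quotient.mk (QuotientGroup.rightRel Γ) g

/-- the right action of `G` on `Γ\G`: `(Γg)g' = Γgg'`. -/
def rmul (Γ : Subgroup SL2) (x : XQuot Γ) (g : SL2) : XQuot Γ :=
  Quotient.map' (fun h => h * g)
    (fun a b hab => by
      rw [QuotientGroup.rightRel_apply] at hab ⊢
      simpa [mul_assoc] using hab) x

/-- `Γ` is a lattice in `SL(2,ℝ)`: a discrete subgroup of finite covolume. -/
def IsLatticeSL2 (Γ : Subgroup SL2) : Prop :=
  DiscreteTopology Γ ∧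
    ∃ μG : Measure SL2, μG.IsHaarMeasure ∧
      ∃ F : Set SL2, IsFundamentalDomain Γ F μG ∧ μG F ≠ ⊤

/-- a function on `Γ\G` is smooth iff its lift to `G ⊆ M₂(ℝ) = ℝ⁴` extends to a smooth
function on the ambient matrix space (equivalently, it is smooth on the manifold `Γ\G`). -/
def IsSmoothQuot (Γ : Subgroup SL2) (ψ : XQuot Γ → ℝ) : Prop :=
  ∃ Ψ : (Fin 2 → Fin 2 → ℝ) → ℝ, ContDiff ℝ (⊤ : ℕ∞) Ψ ∧
    ∀ g : SL2, ψ (qmk Γ g) = Ψ (fun i j => (g : Matrix (Fin 2) (Fin 2) ℝ) i j)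

/-! ### Sums of absolute values of entries -/

/-- The sum of the absolute values of the entries of a `2 × 2` matrix. -/
def entrySum (M : Matrix (Fin 2) (Fin 2) ℝ) : ℝ :=
  |M 0 0| + |M 0 1| + |M 1 0| + |M 1 1|

lemma entrySum_nonneg (M : Matrix (Fin 2) (Fin 2) ℝ) : 0 ≤ entrySum M := by
  unfold entrySum; positivity

lemma entrySum_add_le (M N : Matrix (Fin 2) (Fin 2) ℝ) :
    entrySum (M + N) ≤ entrySum M + entrySum N := by
  simp only [entrySum, Matrix.add_apply]
  linarith [abs_add_le (M 0 0) (N 0 0), abs_add_le (M 0 1) (N 0 1),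
    abs_add_le (M 1 0) (N 1 0), abs_add_le (M 1 1) (N 1 1)]

lemma entrySum_neg (M : Matrix (Fin 2) (Fin 2) ℝ) : entrySum (-M) = entrySum M := by
  simp [entrySum]

lemma entrySum_sub_le (M N : Matrix (Fin 2) (Fin 2) ℝ) :
    entrySum (M - N) ≤ entrySum M + entrySum N := by
  simpa [sub_eq_add_neg, entrySum_neg] using entrySum_add_le M (-N)

lemma entrySum_smul (c : ℝ) (M : Matrix (Fin 2) (Fin 2) ℝ) :
    entrySum (c • M) = |c| * entrySum M := by
  simp [entrySum, abs_mul]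
  ring

lemma entrySum_one : entrySum 1 = 2 := by
  norm_num [entrySum]

lemma entrySum_mul_le (M N : Matrix (Fin 2) (Fin 2) ℝ) :
    entrySum (M * N) ≤ entrySum M * entrySum N := by
  have key : ∀ a b c d : ℝ, |a * b + c * d| ≤ |a| * |b| + |c| * |d| := fun a b c d => by
    simpa [abs_mul] using abs_add_le (a * b) (c * d)
  have h : ∀ i j k l : Fin 2, 0 ≤ |M i j| * |N k l| := fun i j k l => by positivity
  simp only [entrySum, Matrix.mul_apply, Fin.sum_univ_two]
  linarith [key (M 0 0) (N 0 0) (M 0 1) (N 1 0), key (M 0 0) (N 0 1) (M 0 1) (N 1 1),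
    key (M 1 0) (N 0 0) (M 1 1) (N 1 0), key (M 1 0) (N 0 1) (M 1 1) (N 1 1),
    h 0 0 1 0, h 0 0 1 1, h 0 1 0 0, h 0 1 0 1, h 1 0 1 0, h 1 0 1 1, h 1 1 0 0, h 1 1 0 1]

lemma abs_apply_le_entrySum (M : Matrix (Fin 2) (Fin 2) ℝ) (i j : Fin 2) :
    |M i j| ≤ entrySum M := by
  have h00 := abs_nonneg (M 0 0)
  have h01 := abs_nonneg (M 0 1)
  have h10 := abs_nonneg (M 1 0)
  have h11 := abs_nonneg (M 1 1)
  unfold entrySum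
  fin_cases i <;> fin_cases j <;> simp <;> linarith

lemma eq_zero_of_entrySum_eq_zero {M : Matrix (Fin 2) (Fin 2) ℝ} (h : entrySum M = 0) :
    M = 0 := by
  ext i j
  exact abs_nonpos_iff.mp ((abs_apply_le_entrySum M i j).trans h.le)

/-- The distance of an element of `SL(2,ℝ)` from the identity, measured by `entrySum`. -/
def distOne (g : SL2) : ℝ := entrySum ((g : Matrix (Fin 2) (Fin 2) ℝ) - 1)

lemma distOne_nonneg (g : SL2) : 0 ≤ distOne g := entrySum_nonneg _

lemma distOne_one : distOne 1 = 0 := by simp [distOne, entrySum]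

lemma distOne_pos {g : SL2} (hg : g ≠ 1) : 0 < distOne g := by
  refine lt_of_le_of_ne (distOne_nonneg g) fun h => hg ?_
  exact Subtype.ext (sub_eq_zero.mp (eq_zero_of_entrySum_eq_zero h.symm))

lemma entrySum_inv (g : SL2) :
    entrySum ((g⁻¹ : SL2) : Matrix (Fin 2) (Fin 2) ℝ) = entrySum (g : Matrix (Fin 2) (Fin 2) ℝ) := by
  rw [Matrix.SpecialLinearGroup.coe_inv, Matrix.adjugate_fin_two]
  simp [entrySum]
  ring

lemma entrySum_coe_le (g : SL2) : entrySum (g : Matrix (Fin 2) (Fin 2) ℝ) ≤ distOne g + 2 := by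
  have := entrySum_add_le ((g : Matrix (Fin 2) (Fin 2) ℝ) - 1) 1
  rwa [sub_add_cancel, entrySum_one] at this

lemma coe_mul_coe_inv (g : SL2) :
    (g : Matrix (Fin 2) (Fin 2) ℝ) * ((g⁻¹ : SL2) : Matrix (Fin 2) (Fin 2) ℝ) = 1 := by
  rw [← Matrix.SpecialLinearGroup.coe_mul, mul_inv_cancel, Matrix.SpecialLinearGroup.coe_one]

lemma distOne_conj_le (k g : SL2) :
    distOne (k * g * k⁻¹) ≤ entrySum (k : Matrix (Fin 2) (Fin 2) ℝ) ^ 2 * distOne g := by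
  have h : ((k * g * k⁻¹ : SL2) : Matrix (Fin 2) (Fin 2) ℝ) - 1
      = (k : Matrix (Fin 2) (Fin 2) ℝ) * ((g : Matrix (Fin 2) (Fin 2) ℝ) - 1)
        * ((k⁻¹ : SL2) : Matrix (Fin 2) (Fin 2) ℝ) := by
    rw [mul_sub, sub_mul, mul_one, coe_mul_coe_inv]
    simp only [Matrix.SpecialLinearGroup.coe_mul]
  unfold distOne
  rw [h]
  refine (entrySum_mul_le _ _).trans ?_
  rw [entrySum_inv]
  calc _ ≤ (entrySum (k : Matrix (Fin 2) (Fin 2) ℝ)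
          * entrySum ((g : Matrix (Fin 2) (Fin 2) ℝ) - 1)) * entrySum (k : Matrix (Fin 2) (Fin 2) ℝ) :=
        mul_le_mul_of_nonneg_right (entrySum_mul_le _ _) (entrySum_nonneg _)
    _ = _ := by ring

/-- Commutators of elements close to the identity are much closer to the identity. -/
lemma distOne_commutator_le {a b : SL2} (ha : distOne a < 1 / 36) (hb : distOne b < 1 / 36) :
    distOne (a * b * a⁻¹ * b⁻¹) ≤ distOne a / 2 := by
  have h : ((a * b * a⁻¹ * b⁻¹ : SL2) : Matrix (Fin 2) (Fin 2) ℝ) - 1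
      = (((a : Matrix (Fin 2) (Fin 2) ℝ) - 1) * ((b : Matrix (Fin 2) (Fin 2) ℝ) - 1)
        - ((b : Matrix (Fin 2) (Fin 2) ℝ) - 1) * ((a : Matrix (Fin 2) (Fin 2) ℝ) - 1))
        * (((a⁻¹ : SL2) : Matrix (Fin 2) (Fin 2) ℝ)
          * ((b⁻¹ : SL2) : Matrix (Fin 2) (Fin 2) ℝ)) := by
    have e : (((a : Matrix (Fin 2) (Fin 2) ℝ) - 1) * ((b : Matrix (Fin 2) (Fin 2) ℝ) - 1)
        - ((b : Matrix (Fin 2) (Fin 2) ℝ) - 1) * ((a : Matrix (Fin 2) (Fin 2) ℝ) - 1))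
        = (a : Matrix (Fin 2) (Fin 2) ℝ) * b - (b : Matrix (Fin 2) (Fin 2) ℝ) * a := by
      noncomm_ring
    have e' : (b : Matrix (Fin 2) (Fin 2) ℝ) * a * (((a⁻¹ : SL2) : Matrix (Fin 2) (Fin 2) ℝ)
          * ((b⁻¹ : SL2) : Matrix (Fin 2) (Fin 2) ℝ)) = 1 := by
      rw [mul_assoc, ← mul_assoc (a : Matrix (Fin 2) (Fin 2) ℝ), coe_mul_coe_inv, one_mul,
        coe_mul_coe_inv]
    rw [e, sub_mul, e']
    simp only [Matrix.SpecialLinearGroup.coe_mul, mul_assoc]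
  have hA := distOne_nonneg a
  have hB := distOne_nonneg b
  have h1 := entrySum_mul_le ((a : Matrix (Fin 2) (Fin 2) ℝ) - 1) ((b : Matrix (Fin 2) (Fin 2) ℝ) - 1)
  have h2 := entrySum_mul_le ((b : Matrix (Fin 2) (Fin 2) ℝ) - 1) ((a : Matrix (Fin 2) (Fin 2) ℝ) - 1)
  have h3 := entrySum_sub_le
    (((a : Matrix (Fin 2) (Fin 2) ℝ) - 1) * ((b : Matrix (Fin 2) (Fin 2) ℝ) - 1))
    (((b : Matrix (Fin 2) (Fin 2) ℝ) - 1) * ((a : Matrix (Fin 2) (Fin 2) ℝ) - 1))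
  have h4 := entrySum_mul_le ((a⁻¹ : SL2) : Matrix (Fin 2) (Fin 2) ℝ)
    ((b⁻¹ : SL2) : Matrix (Fin 2) (Fin 2) ℝ)
  rw [entrySum_inv, entrySum_inv] at h4
  have h5 : entrySum (a : Matrix (Fin 2) (Fin 2) ℝ) * entrySum (b : Matrix (Fin 2) (Fin 2) ℝ)
      ≤ 3 * 3 :=
    mul_le_mul (by linarith [entrySum_coe_le a]) (by linarith [entrySum_coe_le b])
      (entrySum_nonneg _) (by norm_num)
  have h6 := entrySum_mul_le (((a : Matrix (Fin 2) (Fin 2) ℝ) - 1) * ((b : Matrix (Fin 2) (Fin 2) ℝ) - 1)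
        - ((b : Matrix (Fin 2) (Fin 2) ℝ) - 1) * ((a : Matrix (Fin 2) (Fin 2) ℝ) - 1))
        (((a⁻¹ : SL2) : Matrix (Fin 2) (Fin 2) ℝ)
          * ((b⁻¹ : SL2) : Matrix (Fin 2) (Fin 2) ℝ))
  rw [← h] at h6
  change distOne (a * b * a⁻¹ * b⁻¹) ≤ _ at h6
  change _ ≤ distOne a * distOne b at h1
  change _ ≤ distOne b * distOne a at h2
  refine h6.trans ((mul_le_mul (h3.trans (add_le_add h1 h2)) (h4.trans h5) (entrySum_nonneg _)
    (by positivity)).trans ?_)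
  nlinarith

/-! ### Commuting elements -/

/-- An element of `SL(2,ℝ)` close to but different from the identity is not a scalar matrix. -/
lemma not_scalar_of_distOne_lt {a : SL2} (ha : distOne a < 1) (h1 : a ≠ 1) :
    ¬ (a 0 1 = 0 ∧ a 1 0 = 0 ∧ a 0 0 = a 1 1) := by
  rintro ⟨h01, h10, h00⟩
  have hdet : a 0 0 * a 1 1 - a 0 1 * a 1 0 = 1 := by
    rw [← Matrix.det_fin_two]; exact a.2
  have hlt : |a 0 0 - 1| < 1 := by
    refine lt_of_le_of_lt ?_ ha
    simpa [distOne] using abs_apply_le_entrySum ((a : Matrix (Fin 2) (Fin 2) ℝ) - 1) 0 0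
  rw [abs_lt] at hlt
  have h11 : a 1 1 = 1 := by
    have : (a 1 1 - 1) * (a 1 1 + 1) = 0 := by rw [h00, h01] at hdet; linarith
    rcases mul_eq_zero.mp this with h | h <;> linarith
  apply h1
  ext i j
  fin_cases i <;> fin_cases j <;> simp [h01, h10, h00, h11]

/-- The commutant of a non-scalar `2 × 2` matrix consists of polynomials in it. -/
lemma exists_eq_smul_one_add_smul {A B : Matrix (Fin 2) (Fin 2) ℝ}
    (hA : ¬ (A 0 1 = 0 ∧ A 1 0 = 0 ∧ A 0 0 = A 1 1)) (hAB : A * B = B * A) :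
    ∃ x y : ℝ, B = x • 1 + y • A := by
  have e00 := congrFun (congrFun hAB 0) 0
  have e01 := congrFun (congrFun hAB 0) 1
  have e10 := congrFun (congrFun hAB 1) 0
  simp only [Matrix.mul_apply, Fin.sum_univ_two] at e00 e01 e10
  by_cases h01 : A 0 1 = 0
  · by_cases h10 : A 1 0 = 0
    · have hd : A 0 0 - A 1 1 ≠ 0 := fun h => hA ⟨h01, h10, sub_eq_zero.mp h⟩
      have b01 : B 0 1 = 0 := by
        have : (A 0 0 - A 1 1) * B 0 1 = 0 := by rw [h01] at e01; linarith
        exact (mul_eq_zero.mp this).resolve_left hd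
      have b10 : B 1 0 = 0 := by
        have : (A 0 0 - A 1 1) * B 1 0 = 0 := by rw [h10] at e10; linarith
        exact (mul_eq_zero.mp this).resolve_left hd
      refine ⟨B 0 0 - (B 0 0 - B 1 1) / (A 0 0 - A 1 1) * A 0 0,
        (B 0 0 - B 1 1) / (A 0 0 - A 1 1), ?_⟩
      ext i j
      fin_cases i <;> fin_cases j <;> simp [h01, h10, b01, b10]
      field_simp
      ring
    · refine ⟨B 0 0 - B 1 0 / A 1 0 * A 0 0, B 1 0 / A 1 0, ?_⟩
      ext i j
      fin_cases i <;> fin_cases j <;> simp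
      · field_simp; linarith
      · field_simp
      · field_simp; linarith
  · refine ⟨B 0 0 - B 0 1 / A 0 1 * A 0 0, B 0 1 / A 0 1, ?_⟩
    ext i j
    fin_cases i <;> fin_cases j <;> simp
    · field_simp
    · field_simp; linarith
    · field_simp; linarith

lemma commute_of_commute_not_scalar {a b c : SL2}
    (ha : ¬ (a 0 1 = 0 ∧ a 1 0 = 0 ∧ a 0 0 = a 1 1)) (hb : a * b = b * a) (hc : a * c = c * a) :
    b * c = c * b := by
  have coe_comm : ∀ {x y : SL2}, x * y = y * x →
      (x : Matrix (Fin 2) (Fin 2) ℝ) * y = y * (x : Matrix (Fin 2) (Fin 2) ℝ) := fun h => by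
    simpa only [Matrix.SpecialLinearGroup.coe_mul] using congrArg Subtype.val h
  obtain ⟨x, y, hxy⟩ := exists_eq_smul_one_add_smul ha (coe_comm hb)
  obtain ⟨z, w, hzw⟩ := exists_eq_smul_one_add_smul ha (coe_comm hc)
  apply Subtype.ext
  rw [Matrix.SpecialLinearGroup.coe_mul, Matrix.SpecialLinearGroup.coe_mul, hxy, hzw]
  simp only [add_mul, mul_add, smul_mul_assoc, mul_smul_comm, one_mul, mul_one]
  module

/-- A Zassenhaus neighbourhood: elements close to the identity in a discrete subgroup commute. -/
lemma commute_of_distOne_lt {Λ : Subgroup SL2} {δ : ℝ} (hδ : 0 < δ)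
    (hiso : ∀ γ ∈ Λ, distOne γ < δ → γ = 1) {b c : SL2} (hb : b ∈ Λ) (hc : c ∈ Λ)
    (hb' : distOne b < 1 / 36) (hc' : distOne c < 1 / 36) : b * c = c * b := by
  by_cases hb1 : b = 1
  · simp [hb1]
  let S : Set ℝ := {r | ∃ γ ∈ Λ, γ ≠ 1 ∧ distOne γ < 1 / 36 ∧ distOne γ = r}
  have hbdd : ∀ r ∈ S, δ ≤ r := by
    rintro r ⟨γ, hγ, hγ1, -, rfl⟩
    exact not_lt.mp fun h => hγ1 (hiso γ hγ h)
  have hne : S.Nonempty := ⟨_, b, hb, hb1, hb', rfl⟩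
  have hpos : 0 < sInf S := hδ.trans_le (le_csInf hne hbdd)
  obtain ⟨_, ⟨a, ha, ha1, ha', rfl⟩, hlt⟩ :=
    exists_lt_of_csInf_lt hne (show sInf S < 2 * sInf S by linarith)
  have key : ∀ d ∈ Λ, distOne d < 1 / 36 → a * d = d * a := by
    intro d hd hd'
    have hle := distOne_commutator_le ha' hd'
    by_contra hcomm
    have hne1 : a * d * a⁻¹ * d⁻¹ ≠ 1 := fun h => hcomm (by
      rwa [mul_inv_eq_one, mul_inv_eq_iff_eq_mul] at h)
    have : sInf S ≤ distOne (a * d * a⁻¹ * d⁻¹) := by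
      refine csInf_le ⟨δ, hbdd⟩ ⟨_, ?_, hne1, ?_, rfl⟩
      · exact Λ.mul_mem (Λ.mul_mem (Λ.mul_mem ha hd) (Λ.inv_mem ha)) (Λ.inv_mem hd)
      · linarith [distOne_nonneg a]
    linarith
  exact commute_of_commute_not_scalar (not_scalar_of_distOne_lt (by linarith) ha1)
    (key b hb hb') (key c hc hc')

/-! ### Conjugation by the one-parameter groups -/

lemma hmat_add (s t : ℝ) : hmat (s + t) = hmat s * hmat t := by
  ext i j
  rw [Matrix.SpecialLinearGroup.coe_mul]
  fin_cases i <;> fin_cases j <;>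
    simp [hmat, Matrix.mul_apply, add_div, Real.cosh_add, Real.sinh_add] <;> ring

lemma hmat_inv_coe (s : ℝ) : (((hmat s)⁻¹ : SL2) : Matrix (Fin 2) (Fin 2) ℝ)
    = !![Real.cosh (s/2), -Real.sinh (s/2); -Real.sinh (s/2), Real.cosh (s/2)] := by
  rw [Matrix.SpecialLinearGroup.coe_inv, Matrix.adjugate_fin_two]
  simp [hmat]

lemma hmat_conj_coe (s : ℝ) (g : SL2) :
    (((hmat s)⁻¹ * g * hmat s : SL2) : Matrix (Fin 2) (Fin 2) ℝ)
      = !![Real.cosh (s/2), -Real.sinh (s/2); -Real.sinh (s/2), Real.cosh (s/2)]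
        * (g : Matrix (Fin 2) (Fin 2) ℝ)
        * !![Real.cosh (s/2), Real.sinh (s/2); Real.sinh (s/2), Real.cosh (s/2)] := by
  rw [Matrix.SpecialLinearGroup.coe_mul, Matrix.SpecialLinearGroup.coe_mul, hmat_inv_coe]
  rfl

lemma hmat_conj_trace (s : ℝ) (g : SL2) :
    ((hmat s)⁻¹ * g * hmat s) 0 0 + ((hmat s)⁻¹ * g * hmat s) 1 1 = g 0 0 + g 1 1 := by
  rw [hmat_conj_coe]
  simp only [Matrix.mul_apply, Fin.sum_univ_two, Matrix.of_apply, Matrix.cons_val', Matrix.cons_val_zero,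
    Matrix.cons_val_one, Matrix.cons_val_fin_one]
  linear_combination (g 0 0 + g 1 1) * Real.cosh_sq_sub_sinh_sq (s/2)

lemma hmat_conj_antidiag (s : ℝ) (g : SL2) :
    ((hmat s)⁻¹ * g * hmat s) 0 1 + ((hmat s)⁻¹ * g * hmat s) 1 0 = g 0 1 + g 1 0 := by
  rw [hmat_conj_coe]
  simp only [Matrix.mul_apply, Fin.sum_univ_two, Matrix.of_apply, Matrix.cons_val', Matrix.cons_val_zero,
    Matrix.cons_val_one, Matrix.cons_val_fin_one]
  linear_combination (g 0 1 + g 1 0) * Real.cosh_sq_sub_sinh_sq (s/2)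

/-- The expanding coordinate of conjugation by `hmat`. -/
lemma hmat_conj_expanding (s : ℝ) (g : SL2) :
    ((hmat s)⁻¹ * g * hmat s) 0 0 - ((hmat s)⁻¹ * g * hmat s) 1 1
      + ((hmat s)⁻¹ * g * hmat s) 0 1 - ((hmat s)⁻¹ * g * hmat s) 1 0
      = Real.exp s * (g 0 0 - g 1 1 + g 0 1 - g 1 0) := by
  have he : Real.exp s = (Real.cosh (s/2) + Real.sinh (s/2)) ^ 2 := by
    rw [Real.cosh_add_sinh, ← Real.exp_nat_mul]; congr 1; push_cast; ring
  rw [hmat_conj_coe, he]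
  simp only [Matrix.mul_apply, Fin.sum_univ_two, Matrix.of_apply, Matrix.cons_val', Matrix.cons_val_zero,
    Matrix.cons_val_one, Matrix.cons_val_fin_one]
  ring

lemma distOne_hmat_amat_conj_le {g : SL2} {q : ℝ}
    (hg : (g : Matrix (Fin 2) (Fin 2) ℝ) = !![1 - q, q; -q, 1 + q]) (s T : ℝ) :
    distOne ((hmat s * amat T)⁻¹ * g * (hmat s * amat T)) ≤ 4 * |q| * Real.exp (|T| - s) := by
  have hs : (((hmat s)⁻¹ * g * hmat s : SL2) : Matrix (Fin 2) (Fin 2) ℝ)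
      = !![1 - q * Real.exp (-s), q * Real.exp (-s); -(q * Real.exp (-s)),
        1 + q * Real.exp (-s)] := by
    have he : Real.exp (-s) = (Real.cosh (s/2) - Real.sinh (s/2)) ^ 2 := by
      rw [Real.cosh_sub_sinh, ← Real.exp_nat_mul]; congr 1; push_cast; ring
    have hcs := Real.cosh_sq_sub_sinh_sq (s/2)
    rw [hmat_conj_coe, he, hg]
    ext i j
    fin_cases i <;> fin_cases j <;> simp [Matrix.mul_apply, Fin.sum_univ_two, -Real.cosh_sub_sinh]
    · linear_combination hcs
    · ring
    · ring
    · linear_combination hcs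
  have hT1 : Real.exp (-(T/2)) * Real.exp (T/2) = 1 := by rw [← Real.exp_add]; simp
  have hT2 : Real.exp (-(T/2)) * Real.exp (-(T/2)) = Real.exp (-T) := by
    rw [← Real.exp_add]; congr 1; ring
  have hT3 : Real.exp (T/2) * Real.exp (T/2) = Real.exp T := by
    rw [← Real.exp_add]; congr 1; ring
  have hconj : (((hmat s * amat T)⁻¹ * g * (hmat s * amat T) : SL2) : Matrix (Fin 2) (Fin 2) ℝ)
      = !![1 - q * Real.exp (-s), q * Real.exp (-s) * Real.exp (-T);
        -(q * Real.exp (-s) * Real.exp T), 1 + q * Real.exp (-s)] := by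
    rw [show (hmat s * amat T)⁻¹ * g * (hmat s * amat T)
      = (amat T)⁻¹ * ((hmat s)⁻¹ * g * hmat s) * amat T by group]
    rw [Matrix.SpecialLinearGroup.coe_mul, Matrix.SpecialLinearGroup.coe_mul, hs,
      Matrix.SpecialLinearGroup.coe_inv, Matrix.adjugate_fin_two]
    ext i j
    fin_cases i <;> fin_cases j <;> simp [Matrix.mul_apply, Fin.sum_univ_two, amat]
    · linear_combination (1 - q * Real.exp (-s)) * hT1
    · linear_combination (q * Real.exp (-s)) * hT2
    · linear_combination (q * Real.exp (-s)) * hT3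
    · linear_combination (1 + q * Real.exp (-s)) * hT1
  have e1 : Real.exp (|T| - s) = Real.exp (-s) * Real.exp |T| := by
    rw [← Real.exp_add]; congr 1; ring
  have l0 : 1 ≤ Real.exp |T| := Real.one_le_exp (abs_nonneg T)
  have l1 : Real.exp T ≤ Real.exp |T| := Real.exp_le_exp.mpr (le_abs_self T)
  have l2 : Real.exp (-T) ≤ Real.exp |T| := Real.exp_le_exp.mpr (neg_le_abs T)
  have hq : 0 ≤ |q| * Real.exp (-s) := by positivity
  unfold distOne
  rw [hconj, e1]
  simp only [entrySum, Matrix.sub_apply, Matrix.of_apply, Matrix.cons_val', Matrix.cons_val_zero,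
    Matrix.cons_val_one, Matrix.cons_val_fin_one, Matrix.one_apply_eq, ne_eq, zero_ne_one,
    one_ne_zero, not_false_eq_true, Matrix.one_apply_ne, sub_zero, abs_neg, abs_mul, Real.abs_exp,
    add_sub_cancel_left, sub_sub_cancel_left]
  nlinarith [mul_le_mul_of_nonneg_left l0 hq, mul_le_mul_of_nonneg_left l1 hq,
    mul_le_mul_of_nonneg_left l2 hq]

/-! ### The unipotent element attached to a divergent trajectory -/

lemma commute_of_distOne_conj_lt {Λ : Subgroup SL2} {δ : ℝ} (hδ : 0 < δ)
    (hiso : ∀ γ ∈ Λ, distOne γ < δ → γ = 1) (k : SL2) {b c : SL2} (hb : b ∈ Λ) (hc : c ∈ Λ)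
    (hb' : distOne (k⁻¹ * b * k) < 1 / 36) (hc' : distOne (k⁻¹ * c * k) < 1 / 36) :
    b * c = c * b := by
  have hmem : ∀ x ∈ Λ, k⁻¹ * x * k ∈ Λ.map (MulAut.conj k⁻¹).toMonoidHom := fun x hx =>
    ⟨x, hx, by simp⟩
  have hK : 0 < entrySum (k : Matrix (Fin 2) (Fin 2) ℝ) ^ 2 + 1 := by positivity
  have h := commute_of_distOne_lt (Λ := Λ.map (MulAut.conj k⁻¹).toMonoidHom) (div_pos hδ hK)
    (by
      rintro _ ⟨γ, hγ, rfl⟩ hlt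
      have hle := distOne_conj_le k (k⁻¹ * γ * k)
      rw [show k * (k⁻¹ * γ * k) * k⁻¹ = γ by group] at hle
      have hlt' : distOne (k⁻¹ * γ * k) < δ / (entrySum (k : Matrix (Fin 2) (Fin 2) ℝ) ^ 2 + 1) := by
        simpa using hlt
      rw [lt_div_iff₀ hK] at hlt'
      have : γ = 1 := hiso γ hγ (by nlinarith [distOne_nonneg (k⁻¹ * γ * k)])
      simp [this])
    (hmem b hb) (hmem c hc) hb' hc'
  have e : ∀ x y : SL2, k⁻¹ * x * k * (k⁻¹ * y * k) = k⁻¹ * (x * y) * k := fun x y => by group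
  rw [e, e] at h
  simpa using h

/-- If the conjugates of a discrete group along `hmat s` contain nontrivial elements arbitrarily
close to `1` as `s → ∞`, then the group contains a unipotent contracted by this conjugation. -/
lemma exists_contracted_unipotent {Λ : Subgroup SL2} {δ : ℝ} (hδ : 0 < δ)
    (hiso : ∀ γ ∈ Λ, distOne γ < δ → γ = 1)
    (hray : ∀ r > 0, ∃ S : ℝ, ∀ s ≥ S, ∃ γ ∈ Λ, γ ≠ 1 ∧
      distOne ((hmat s)⁻¹ * γ * hmat s) < r) :
    ∃ γ ∈ Λ, γ ≠ 1 ∧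
      ∃ q : ℝ, (γ : Matrix (Fin 2) (Fin 2) ℝ) = !![1 - q, q; -q, 1 + q] := by
  obtain ⟨K, hKdef⟩ : ∃ K, K = entrySum ((hmat 1)⁻¹ : SL2).1 ^ 2 := ⟨_, rfl⟩
  have hK : 0 ≤ K := hKdef ▸ sq_nonneg _
  obtain ⟨ε, hεdef⟩ : ∃ ε : ℝ, ε = 1 / 36 / (K + 1) := ⟨_, rfl⟩
  have hε : 0 < ε := hεdef ▸ by positivity
  have hεK : ε * (K + 1) = 1 / 36 := by rw [hεdef]; field_simp
  have hε1 : ε ≤ 1 / 36 := by nlinarith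
  obtain ⟨S, hS⟩ := hray ε hε
  obtain ⟨n₀, hn₀⟩ := exists_nat_ge S
  obtain ⟨α, hα, hα1, hαd⟩ := hS n₀ hn₀
  have conj_ne_one : ∀ (k : SL2) {x : SL2}, x ≠ 1 → k⁻¹ * x * k ≠ 1 := fun k x hx h =>
    hx (by simpa [inv_mul_eq_iff_eq_mul, mul_assoc] using h)
  have commutes : ∀ n : ℕ, n₀ ≤ n → ∀ γ ∈ Λ, distOne ((hmat n)⁻¹ * γ * hmat n) < ε →
      α * γ = γ * α := by
    intro n hn
    induction n, hn using Nat.le_induction with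
    | base =>
      intro γ hγ hd
      exact commute_of_distOne_conj_lt hδ hiso (hmat n₀) hα hγ (by linarith) (by linarith)
    | succ n hn ih =>
      intro γ hγ hd
      obtain ⟨β, hβ, hβ1, hβd⟩ := hS n (hn₀.trans (by exact_mod_cast hn))
      have hβd' : distOne ((hmat (n + 1 : ℕ))⁻¹ * β * hmat (n + 1 : ℕ)) < 1 / 36 := by
        have hle := distOne_conj_le (hmat 1)⁻¹ ((hmat n)⁻¹ * β * hmat n)
        rw [← hKdef] at hle
        rw [Nat.cast_add, Nat.cast_one, hmat_add,
          show (hmat n * hmat 1)⁻¹ * β * (hmat n * hmat 1)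
            = (hmat 1)⁻¹ * ((hmat n)⁻¹ * β * hmat n) * ((hmat 1)⁻¹)⁻¹ by group]
        nlinarith
      have h1 : β * α = α * β := (ih β hβ hβd).symm
      have h2 : β * γ = γ * β :=
        commute_of_distOne_conj_lt hδ hiso (hmat (n + 1 : ℕ)) hβ hγ hβd' (by linarith)
      have hβ36 : distOne ((hmat n)⁻¹ * β * hmat n) < 1 := by linarith
      have conj_mul : ∀ x y : SL2, ((hmat n)⁻¹ * x * hmat n) * ((hmat n)⁻¹ * y * hmat n)
          = (hmat n)⁻¹ * (x * y) * hmat n := fun x y => by group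
      have := commute_of_commute_not_scalar
        (not_scalar_of_distOne_lt hβ36 (conj_ne_one _ hβ1))
        (b := (hmat n)⁻¹ * α * hmat n) (c := (hmat n)⁻¹ * γ * hmat n)
        (by rw [conj_mul, conj_mul, h1]) (by rw [conj_mul, conj_mul, h2])
      rw [conj_mul, conj_mul] at this
      simpa using this
  have hα_scalar : ¬ (α 0 1 = 0 ∧ α 1 0 = 0 ∧ α 0 0 = α 1 1) := by
    rintro ⟨h01, h10, h00⟩
    have hdet : α 0 0 * α 1 1 - α 0 1 * α 1 0 = 1 := by
      rw [← Matrix.det_fin_two]; exact α.2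
    refine not_scalar_of_distOne_lt (by linarith) (conj_ne_one (hmat n₀) hα1) ?_
    have hc : (α : Matrix (Fin 2) (Fin 2) ℝ) = α 1 1 • 1 := by
      ext i j; fin_cases i <;> fin_cases j <;> simp [h01, h10, h00]
    have hconj : (((hmat n₀)⁻¹ * α * hmat n₀ : SL2) : Matrix (Fin 2) (Fin 2) ℝ) = α 1 1 • 1 := by
      rw [Matrix.SpecialLinearGroup.coe_mul, Matrix.SpecialLinearGroup.coe_mul, hc]
      simp only [mul_smul_comm, smul_mul_assoc, mul_one]
      rw [← Matrix.SpecialLinearGroup.coe_mul, inv_mul_cancel]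
      simp
    rw [hconj]
    simp
  have hseq : ∀ k : ℕ, ∃ n : ℕ, ∃ γ ∈ Λ, γ ≠ 1 ∧ α * γ = γ * α ∧
      distOne ((hmat n)⁻¹ * γ * hmat n) < 1 / ((k : ℝ) + 1) := by
    intro k
    obtain ⟨S', hS'⟩ := hray (min ε (1 / ((k : ℝ) + 1))) (lt_min hε (by positivity))
    obtain ⟨m, hm⟩ := exists_nat_ge S'
    obtain ⟨γ, hγ, hγ1, hd⟩ := hS' (max m n₀ : ℕ) (hm.trans (by simp))
    exact ⟨max m n₀, γ, hγ, hγ1, commutes _ (le_max_right _ _) γ hγ (hd.trans_le (min_le_left _ _)),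
      hd.trans_le (min_le_right _ _)⟩
  choose n γ hγ hγ1 hcomm hd using hseq
  have hpoly : ∀ k, ∃ x y : ℝ, (γ k : Matrix (Fin 2) (Fin 2) ℝ)
      = x • 1 + y • (α : Matrix (Fin 2) (Fin 2) ℝ) := fun k =>
    exists_eq_smul_one_add_smul hα_scalar (by
      simpa only [Matrix.SpecialLinearGroup.coe_mul] using congrArg Subtype.val (hcomm k))
  choose x y hxy using hpoly
  have hlim : Tendsto (fun k : ℕ => 1 / ((k : ℝ) + 1)) atTop (𝓝 0) :=
    tendsto_one_div_add_atTop_nhds_zero_nat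
  have entry : ∀ k (i j : Fin 2), |((hmat (n k))⁻¹ * γ k * hmat (n k)) i j
      - (1 : Matrix (Fin 2) (Fin 2) ℝ) i j| ≤ 1 / ((k : ℝ) + 1) := fun k i j =>
    (abs_apply_le_entrySum ((((hmat (n k))⁻¹ * γ k * hmat (n k) : SL2) :
      Matrix (Fin 2) (Fin 2) ℝ) - 1) i j).trans (hd k).le
  have bound_antidiag : ∀ k, |y k * (α 0 1 + α 1 0)| ≤ 2 * (1 / ((k : ℝ) + 1)) := by
    intro k
    have h01 := entry k 0 1
    have h10 := entry k 1 0
    have h := hmat_conj_antidiag (n k) (γ k)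
    simp only [ne_eq, zero_ne_one, one_ne_zero, not_false_eq_true, Matrix.one_apply_ne,
      sub_zero] at h01 h10
    have e : γ k 0 1 + γ k 1 0 = y k * (α 0 1 + α 1 0) := by rw [hxy]; simp; ring
    rw [← e, ← h]
    exact (abs_add_le _ _).trans (by linarith)
  have bound_expanding : ∀ k, |y k * (α 0 0 - α 1 1 + α 0 1 - α 1 0)| ≤ 4 * (1 / ((k : ℝ) + 1)) := by
    intro k
    have h00 := abs_le.mp (entry k 0 0)
    have h01 := abs_le.mp (entry k 0 1)
    have h10 := abs_le.mp (entry k 1 0)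
    have h11 := abs_le.mp (entry k 1 1)
    have h := hmat_conj_expanding (n k) (γ k)
    simp only [ne_eq, zero_ne_one, one_ne_zero, not_false_eq_true, Matrix.one_apply_ne,
      Matrix.one_apply_eq, sub_zero] at h00 h01 h10 h11
    have e : γ k 0 0 - γ k 1 1 + γ k 0 1 - γ k 1 0 = y k * (α 0 0 - α 1 1 + α 0 1 - α 1 0) := by
      rw [hxy]; simp; ring
    rw [e] at h
    have h1 : 1 ≤ Real.exp (n k) := Real.one_le_exp (Nat.cast_nonneg _)
    calc _ ≤ Real.exp (n k) * |y k * (α 0 0 - α 1 1 + α 0 1 - α 1 0)| :=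
          le_mul_of_one_le_left (abs_nonneg _) h1
      _ = |Real.exp (n k) * (y k * (α 0 0 - α 1 1 + α 0 1 - α 1 0))| := by
          rw [abs_mul (Real.exp _), Real.abs_exp]
      _ ≤ _ := by rw [← h, abs_le]; constructor <;> linarith
  have bound_trace : ∀ k, |2 * (x k - 1) + y k * (α 0 0 + α 1 1)| ≤ 2 * (1 / ((k : ℝ) + 1)) := by
    intro k
    have h00 := abs_le.mp (entry k 0 0)
    have h11 := abs_le.mp (entry k 1 1)
    have h := hmat_conj_trace (n k) (γ k)
    simp only [Matrix.one_apply_eq] at h00 h11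
    have e : γ k 0 0 + γ k 1 1 = 2 * x k + y k * (α 0 0 + α 1 1) := by rw [hxy]; simp; ring
    rw [abs_le]
    constructor <;> linarith
  have y_not_tendsto : ¬ Tendsto y atTop (𝓝 0) := by
    intro hy
    have hx : Tendsto (fun k => x k - 1) atTop (𝓝 0) := by
      have h1 : Tendsto (fun k => 2 * (x k - 1) + y k * (α 0 0 + α 1 1)) atTop (𝓝 0) :=
        squeeze_zero_norm bound_trace (by simpa using hlim.const_mul 2)
      have h2 := (h1.sub (hy.mul_const (α 0 0 + α 1 1))).div_const 2
      simpa using h2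
    have hlim' : Tendsto (fun k => 2 * |x k - 1| + |y k| * entrySum α.1) atTop (𝓝 0) := by
      simpa using (hx.abs.const_mul 2).add (hy.abs.mul_const (entrySum α.1))
    obtain ⟨k, hk⟩ := (hlim'.eventually (gt_mem_nhds hδ)).exists
    refine hγ1 k (hiso _ (hγ k) (lt_of_le_of_lt ?_ hk))
    have e : (γ k : Matrix (Fin 2) (Fin 2) ℝ) - 1
        = (x k - 1) • (1 : Matrix (Fin 2) (Fin 2) ℝ) + y k • (α : Matrix (Fin 2) (Fin 2) ℝ) := by
      rw [hxy]; module
    unfold distOne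
    rw [e]
    refine (entrySum_add_le _ _).trans ?_
    rw [entrySum_smul, entrySum_smul, entrySum_one, mul_comm 2]
  have eq_zero_of_bound : ∀ (v C : ℝ), (∀ k, |y k * v| ≤ C * (1 / ((k : ℝ) + 1))) → v = 0 := by
    intro v C h
    by_contra hv
    have h1 : Tendsto (fun k => y k * v) atTop (𝓝 0) :=
      squeeze_zero_norm h (by simpa using hlim.const_mul C)
    refine y_not_tendsto ?_
    have h2 := h1.div_const v
    simpa [hv] using h2
  have hw := eq_zero_of_bound _ _ bound_antidiag
  have hu := eq_zero_of_bound _ _ bound_expanding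
  have hdet : α 0 0 * α 1 1 - α 0 1 * α 1 0 = 1 := by
    rw [← Matrix.det_fin_two]; exact α.2
  have htr : 0 < α 0 0 + α 1 1 := by
    have e00 := abs_le.mp (abs_apply_le_entrySum ((((hmat n₀)⁻¹ * α * hmat n₀ : SL2) :
      Matrix (Fin 2) (Fin 2) ℝ) - 1) 0 0)
    have e11 := abs_le.mp (abs_apply_le_entrySum ((((hmat n₀)⁻¹ * α * hmat n₀ : SL2) :
      Matrix (Fin 2) (Fin 2) ℝ) - 1) 1 1)
    change distOne ((hmat n₀)⁻¹ * α * hmat n₀) < ε at hαd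
    change -distOne ((hmat n₀)⁻¹ * α * hmat n₀) ≤ _ ∧ _ at e00
    change -distOne ((hmat n₀)⁻¹ * α * hmat n₀) ≤ _ ∧ _ at e11
    rw [Matrix.sub_apply, Matrix.one_apply_eq] at e00 e11
    linarith [hmat_conj_trace n₀ α]
  refine ⟨α, hα, hα1, α 0 1, ?_⟩
  have h10 : α 1 0 = -α 0 1 := by linarith
  have h11 : α 1 1 = α 0 0 + 2 * α 0 1 := by linarith
  have hpq : α 0 0 + α 0 1 = 1 := by
    rw [h10, h11] at hdet
    rw [h11] at htr
    have : (α 0 0 + α 0 1 - 1) * (α 0 0 + α 0 1 + 1) = 0 := by linear_combination hdet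
    rcases mul_eq_zero.mp this with h | h <;> linarith
  ext i j
  fin_cases i <;> fin_cases j <;> simp [h10] <;> linarith

/-! ### Topology of `SL(2,ℝ)` and of the quotient -/

instance : IsTopologicalGroup SL2 := Matrix.SpecialLinearGroup.topologicalGroup

instance : BorelSpace SL2 := ⟨rfl⟩

lemma isClosedEmbedding_coe :
    IsClosedEmbedding (fun g : SL2 => (g : Matrix (Fin 2) (Fin 2) ℝ)) :=
  Matrix.SpecialLinearGroup.isClosedEmbedding_val

instance : LocallyCompactSpace SL2 :=
  haveI : LocallyCompactSpace (Matrix (Fin 2) (Fin 2) ℝ) :=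
    inferInstanceAs (LocallyCompactSpace (Fin 2 → Fin 2 → ℝ))
  isClosedEmbedding_coe.locallyCompactSpace

instance : SecondCountableTopology SL2 :=
  haveI : SecondCountableTopology (Matrix (Fin 2) (Fin 2) ℝ) :=
    inferInstanceAs (SecondCountableTopology (Fin 2 → Fin 2 → ℝ))
  isClosedEmbedding_coe.isEmbedding.secondCountableTopology

lemma nhds_one_eq_comap_distOne : 𝓝 (1 : SL2) = comap distOne (𝓝 0) := by
  apply le_antisymm
  · rw [← tendsto_iff_comap, ← distOne_one]
    have : Continuous distOne := by
      unfold distOne entrySum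
      have h := isClosedEmbedding_coe.continuous
      have hij : ∀ i j : Fin 2, Continuous fun g : SL2 => g i j := fun i j =>
        (continuous_id.matrix_elem i j).comp h
      simp only [Matrix.sub_apply]
      fun_prop
    exact this.tendsto 1
  · rw [← tendsto_id']
    rw [isClosedEmbedding_coe.isInducing.tendsto_nhds_iff]
    refine tendsto_pi_nhds.mpr fun i => tendsto_pi_nhds.mpr fun j => ?_
    refine tendsto_iff_norm_sub_tendsto_zero.mpr ?_
    exact squeeze_zero (fun _ => norm_nonneg _)
      (fun g => abs_apply_le_entrySum ((g : Matrix (Fin 2) (Fin 2) ℝ) - 1) i j) tendsto_comap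

lemma exists_distOne_lt_subset {U : Set SL2} (hU : U ∈ 𝓝 (1 : SL2)) :
    ∃ δ > 0, ∀ g, distOne g < δ → g ∈ U := by
  rw [nhds_one_eq_comap_distOne] at hU
  obtain ⟨t, ht, htU⟩ := hU
  obtain ⟨δ, hδ, hball⟩ := Metric.mem_nhds_iff.mp ht
  refine ⟨δ, hδ, fun g hg => htU (hball ?_)⟩
  simpa [abs_of_nonneg (distOne_nonneg g)] using hg

lemma distOne_lt_mem_nhds {δ : ℝ} (hδ : 0 < δ) : {g : SL2 | distOne g < δ} ∈ 𝓝 (1 : SL2) := by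
  rw [nhds_one_eq_comap_distOne]
  exact preimage_mem_comap (gt_mem_nhds hδ)

lemma qmk_eq_iff {Γ : Subgroup SL2} {a b : SL2} : qmk Γ a = qmk Γ b ↔ b * a⁻¹ ∈ Γ :=
  Quotient.eq.trans QuotientGroup.rightRel_apply

/-- Over a compact subset of `Γ\G`, the conjugates of a discrete `Γ` are uniformly discrete. -/
lemma exists_isolated_of_isCompact {Γ : Subgroup SL2} (hΓ : DiscreteTopology Γ)
    {C : Set (XQuot Γ)} (hC : IsCompact C) :
    ∃ δ > 0, ∀ g, qmk Γ g ∈ C → ∀ γ ∈ Γ, distOne (g⁻¹ * γ * g) < δ → γ = 1 := by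
  obtain ⟨D, hD, hDΓ⟩ : ∃ D ∈ 𝓝 (1 : SL2), ∀ γ ∈ Γ, γ ∈ D → γ = 1 := by
    have h : ({1} : Set Γ) ∈ 𝓝 (1 : Γ) := (isOpen_discrete _).mem_nhds rfl
    rw [nhds_subtype_eq_comap] at h
    obtain ⟨D, hD, hsub⟩ := h
    refine ⟨D, hD, fun γ hγ hγD => ?_⟩
    have : (⟨γ, hγ⟩ : Γ) = 1 := hsub hγD
    exact congrArg Subtype.val this
  refine hC.induction_on (p := fun C => ∃ δ > 0, ∀ g, qmk Γ g ∈ C → ∀ γ ∈ Γ,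
    distOne (g⁻¹ * γ * g) < δ → γ = 1) ⟨1, one_pos, fun _ h => h.elim⟩ ?_ ?_ ?_
  · rintro s t hst ⟨δ, hδ, h⟩
    exact ⟨δ, hδ, fun g hg => h g (hst hg)⟩
  · rintro s t ⟨δ, hδ, h⟩ ⟨δ', hδ', h'⟩
    refine ⟨min δ δ', lt_min hδ hδ', fun g hg γ hγ hlt => ?_⟩
    rcases hg with hg | hg
    · exact h g hg γ hγ (hlt.trans_le (min_le_left _ _))
    · exact h' g hg γ hγ (hlt.trans_le (min_le_right _ _))
  · intro x _
    obtain ⟨g₀, rfl⟩ : ∃ g₀, qmk Γ g₀ = x := Quotient.exists_rep x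
    have hcont : Tendsto (fun p : SL2 × SL2 => p.1 * p.2 * p.1⁻¹) (𝓝 g₀ ×ˢ 𝓝 1) (𝓝 1) := by
      have hc : Continuous (fun p : SL2 × SL2 => p.1 * p.2 * p.1⁻¹) := by fun_prop
      have := hc.tendsto (g₀, 1)
      rwa [nhds_prod_eq, mul_one, mul_inv_cancel] at this
    obtain ⟨O, hO, U, hU, hOU⟩ := mem_prod_iff.mp (hcont hD)
    obtain ⟨δ, hδ, hδU⟩ := exists_distOne_lt_subset hU
    have hopen : IsOpenMap (qmk Γ) := isOpenMap_quotient_mk'_mul (Γ := Γ) (T := SL2)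
    refine ⟨qmk Γ '' O, mem_nhdsWithin_of_mem_nhds (hopen.image_mem_nhds hO), δ, hδ, ?_⟩
    rintro g ⟨g', hg', hgg'⟩ γ hγ hlt
    obtain ⟨η, hη, rfl⟩ : ∃ η ∈ Γ, g = η * g' := ⟨g * g'⁻¹, qmk_eq_iff.mp hgg', by group⟩
    have e : (η * g')⁻¹ * γ * (η * g') = g'⁻¹ * (η⁻¹ * γ * η) * g' := by group
    rw [e] at hlt
    have hmem : g' * (g'⁻¹ * (η⁻¹ * γ * η) * g') * g'⁻¹ ∈ D :=
      hOU (Set.mk_mem_prod hg' (hδU _ hlt))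
    rw [show g' * (g'⁻¹ * (η⁻¹ * γ * η) * g') * g'⁻¹ = η⁻¹ * γ * η by group] at hmem
    have h1 := hDΓ _ (Γ.mul_mem (Γ.mul_mem (Γ.inv_mem hη) hγ) hη) hmem
    simpa [inv_mul_eq_iff_eq_mul, mul_assoc] using h1

open Pointwise in
/-- Outside a compact part of a finite-volume quotient, conjugates of the lattice contain
nontrivial elements close to the identity. -/
lemma exists_isCompact_of_isLatticeSL2 {Γ : Subgroup SL2} (hΓ : IsLatticeSL2 Γ) {U : Set SL2}
    (hU : U ∈ 𝓝 (1 : SL2)) :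
    ∃ K : Set SL2, IsCompact K ∧
      ∀ g, qmk Γ g ∉ qmk Γ '' K → ∃ γ ∈ Γ, γ ≠ 1 ∧ g⁻¹ * γ * g ∈ U := by
  obtain ⟨hdisc, μ, hμ, F, hF, hFfin⟩ := hΓ
  have : Countable Γ := TopologicalSpace.separableSpace_iff_countable.mp inferInstance
  obtain ⟨W, hW, hWU⟩ := exists_nhds_split_inv hU
  obtain ⟨N, hN, hN1⟩ := exists_compact_mem_nhds (1 : SL2)
  obtain ⟨V, hVsub, hVopen, hV1⟩ := mem_nhds_iff.mp (inter_mem hW hN1)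
  by_contra! hcon
  have hfar : ∀ n : ℕ, ∃ t : Finset SL2, t.card = n ∧
      (∀ g ∈ t, ∀ γ ∈ Γ, γ ≠ 1 → g⁻¹ * γ * g ∉ U) ∧
      ∀ g ∈ t, ∀ g' ∈ t, g ≠ g' → ∀ γ ∈ Γ, ∀ v ∈ V, ∀ v' ∈ V, γ * (g * v) ≠ g' * v' := by
    intro n
    induction n with
    | zero => exact ⟨∅, by simp⟩
    | succ n ih =>
      obtain ⟨t, hcard, hinj, hsep⟩ := ih
      have hcompact : IsCompact ((t : Set SL2) * (N * N⁻¹)) :=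
        t.finite_toSet.isCompact.mul (hN.mul hN.inv)
      obtain ⟨g, hg, hgU⟩ := hcon _ hcompact
      have hnew : ∀ g' ∈ t, ∀ γ ∈ Γ, ∀ v ∈ V, ∀ v' ∈ V, γ * (g * v) ≠ g' * v' := by
        intro g' hg' γ hγ v hv v' hv' heq
        refine hg ⟨g' * (v' * v⁻¹), Set.mul_mem_mul hg'
          (Set.mul_mem_mul (hVsub hv').2 (Set.inv_mem_inv.mpr (hVsub hv).2)), ?_⟩
        rw [qmk_eq_iff, ← mul_assoc, ← heq]
        convert Γ.inv_mem hγ using 1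
        group
      have hgt : g ∉ t := fun h => hnew g h 1 Γ.one_mem 1 hV1 1 hV1 (one_mul _)
      refine ⟨insert g t, by rw [Finset.card_insert_of_notMem hgt, hcard], ?_, ?_⟩
      · intro a ha
        rcases Finset.mem_insert.mp ha with rfl | ha
        · exact hgU
        · exact hinj a ha
      · intro a ha b hb hab γ hγ v hv v' hv' heq
        rcases Finset.mem_insert.mp ha with rfl | ha' <;>
          rcases Finset.mem_insert.mp hb with rfl | hb'
        · exact hab rfl
        · exact hnew b hb' γ hγ v hv v' hv' heq
        · exact hnew a ha' γ⁻¹ (Γ.inv_mem hγ) v' hv' v hv (by rw [← heq]; group)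
        · exact hsep a ha' b hb' hab γ hγ v hv v' hv' heq
  have hVpos : μ V ≠ 0 := (hVopen.measure_pos μ ⟨1, hV1⟩).ne'
  obtain ⟨n, hn⟩ := ENNReal.exists_nat_mul_gt hVpos hFfin
  obtain ⟨t, hcard, hinj, hsep⟩ := hfar n
  have hmeas : ∀ g : SL2, MeasurableSet (g • V) := fun g => (hVopen.smul g).measurableSet
  have hvol : μ (⋃ g ∈ t, g • V) = n * μ V := by
    rw [measure_biUnion_finset ?_ fun g _ => hmeas g]
    · simp [measure_smul, hcard]
    · intro a ha b hb hab
      refine Set.disjoint_left.mpr ?_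
      rintro _ ⟨v, hv, rfl⟩ ⟨v', hv', heq⟩
      exact hsep a ha b hb hab 1 Γ.one_mem v hv v' hv' (by rw [one_mul]; exact heq.symm)
  obtain ⟨p, hp, p', hp', γ, hγ1, hγp⟩ := hF.exists_ne_one_smul_eq
    (t.measurableSet_biUnion fun g _ => hmeas g).nullMeasurableSet (hvol ▸ hn)
  simp only [Set.mem_iUnion] at hp hp'
  obtain ⟨a, ha, v, hv, rfl⟩ := hp
  obtain ⟨b, hb, v', hv', rfl⟩ := hp'
  have heq : (γ : SL2) * (a * v) = b * v' := hγp
  by_cases hab : a = b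
  · subst hab
    refine hinj a ha γ γ.2 (fun h => hγ1 (Subtype.ext h)) ?_
    have e : a⁻¹ * γ * a = v' / v := by
      rw [div_eq_mul_inv, eq_mul_inv_iff_mul_eq, mul_assoc, mul_assoc, heq, inv_mul_cancel_left]
    rw [e]
    exact hWU v' (hVsub hv').1 v (hVsub hv).1
  · exact hsep a ha b hb hab γ γ.2 v hv v' hv' heq

/-- the translated divergent geodesic spends no time in a fixed compact set
beyond time `|T| + M₁`. -/
theorem divergent_translate_leaves_compact
    (Γ : Subgroup SL2) (hlat : IsLatticeSL2 Γ)
    (hnonuniform : ¬ IsCompact (Set.univ : Set (XQuot Γ)))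
    (x₀ : XQuot Γ)
    (hdiv : ∀ C : Set (XQuot Γ), IsCompact C →
      ∃ s₁ : ℝ, 0 < s₁ ∧ ∀ s : ℝ, s₁ ≤ s → rmul Γ x₀ (hmat s) ∉ C)
    (C : Set (XQuot Γ)) (hC : IsCompact C) :
    ∃ M₁ > (0:ℝ),
      (∀ T s : ℝ, 0 < s → |T| + M₁ < s → rmul Γ x₀ (hmat s * amat T) ∉ C) ∧
      (∀ f : XQuot Γ → ℝ, Continuous f → tsupport f ⊆ C → ∀ T : ℝ,
        ∫ s in Set.Ioi (0:ℝ), f (rmul Γ x₀ (hmat s * amat T))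
          = ∫ s in Set.Ioc (0:ℝ) (|T| + M₁), f (rmul Γ x₀ (hmat s * amat T))) := by
  obtain ⟨g, rfl⟩ : ∃ g, qmk Γ g = x₀ := Quotient.exists_rep x₀
  have hqmk : Continuous (qmk Γ) := continuous_quotient_mk'
  let Λ : Subgroup SL2 := Γ.map (MulAut.conj g⁻¹).toMonoidHom
  have hmemΛ : ∀ γ ∈ Γ, g⁻¹ * γ * g ∈ Λ := fun γ hγ => ⟨γ, hγ, by simp⟩
  obtain ⟨δ₀, hδ₀, hiso⟩ := exists_isolated_of_isCompact hlat.1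
    (isCompact_singleton (x := qmk Γ g))
  have hisoΛ : ∀ γ ∈ Λ, distOne γ < δ₀ → γ = 1 := by
    rintro _ ⟨γ, hγ, rfl⟩ hlt
    have : γ = 1 := hiso g rfl γ hγ (by simpa using hlt)
    simp [this]
  have hray : ∀ r > 0, ∃ S : ℝ, ∀ s ≥ S, ∃ γ ∈ Λ, γ ≠ 1 ∧
      distOne ((hmat s)⁻¹ * γ * hmat s) < r := by
    intro r hr
    obtain ⟨K, hK, hKout⟩ := exists_isCompact_of_isLatticeSL2 hlat (distOne_lt_mem_nhds hr)
    obtain ⟨S, -, hS⟩ := hdiv _ (hK.image hqmk)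
    refine ⟨S, fun s hs => ?_⟩
    obtain ⟨γ, hγ, hγ1, hd⟩ := hKout (g * hmat s) (hS s hs)
    refine ⟨g⁻¹ * γ * g, hmemΛ γ hγ, fun h => hγ1 ?_, ?_⟩
    · simpa [inv_mul_eq_iff_eq_mul, mul_assoc] using h
    · rwa [Set.mem_ofPred_eq, show (g * hmat s)⁻¹ * γ * (g * hmat s)
        = (hmat s)⁻¹ * (g⁻¹ * γ * g) * hmat s by group] at hd
  obtain ⟨_, ⟨γ, hγ, rfl⟩, hne, q, hq⟩ := exists_contracted_unipotent hδ₀ hisoΛ hray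
  have hγ1 : γ ≠ 1 := by rintro rfl; simp at hne
  obtain ⟨δ, hδ, hδC⟩ := exists_isolated_of_isCompact hlat.1 hC
  have hM : 0 < 4 * |q| / δ + 1 := by positivity
  have hleave : ∀ T s : ℝ, 0 < s → |T| + (4 * |q| / δ + 1) < s →
      rmul Γ (qmk Γ g) (hmat s * amat T) ∉ C := by
    intro T s _ hs hmem
    refine hγ1 (hδC _ hmem γ hγ ?_)
    have hle := distOne_hmat_amat_conj_le hq s T
    rw [show (g * (hmat s * amat T))⁻¹ * γ * (g * (hmat s * amat T))
      = (hmat s * amat T)⁻¹ * ((MulAut.conj g⁻¹).toMonoidHom γ) * (hmat s * amat T) by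
        simp [mul_assoc]]
    refine hle.trans_lt ?_
    have hexp : 4 * |q| / δ < Real.exp (s - |T|) := by linarith [Real.add_one_le_exp (s - |T|)]
    rw [div_lt_iff₀ hδ] at hexp
    have hinv : Real.exp (s - |T|) * Real.exp (|T| - s) = 1 := by rw [← Real.exp_add]; simp
    calc _ < Real.exp (s - |T|) * δ * Real.exp (|T| - s) :=
          mul_lt_mul_of_pos_right hexp (Real.exp_pos _)
      _ = δ := by linear_combination δ * hinv
  refine ⟨4 * |q| / δ + 1, hM, hleave, fun f _ hf T => ?_⟩
  refine setIntegral_eq_of_subset_of_forall_sdiff_eq_zero measurableSet_Ioi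
    Set.Ioc_subset_Ioi_self fun s hs => ?_
  by_contra hne0
  have hs0 : 0 < s := hs.1
  exact hleave T s hs0 (not_le.mp fun h => hs.2 ⟨hs0, h⟩) (hf (subset_tsupport f hne0))
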